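/- Let A, W ∈ SL(2,ℂ), set x := tr A, y := tr W, z := tr(A·W), β := tr(A·W·A·W⁻¹), and for integers m, n let U := (A·W·A·W⁻¹)^(1−m) · W and α := tr U. Then tr(U^(n−1)·A·W·A) = (x·z − y)·S_{n−1}(α) − (β·S_{m−1}(β) − 2·S_{m−2}(β))·S_{n−2}(α). -/

import Mathlib

open Polynomial

/-- The trace of an element of `SL(2,ℂ)`, i.e. the trace of the underlying matrix. -/
noncomputable def tr (A : Matrix.SpecialLinearGroup (Fin 2) ℂ) : ℂ :=
  Matrix.trace (A : Matrix (Fin 2) (Fin 2) ℂ)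

/-- The normalized Chebyshev polynomials `S k` (`k : ℤ`), determined by
`S 0 = 1`, `S 1 = X`, and the recurrence `S (k + 1) = X * S k - S (k - 1)` for all `k : ℤ`. -/
@[semireducible] noncomputable def chebS (R : Type*) [CommRing R] : ℤ → R[X]
  | 0 => 1
  | 1 => X
  | (n : ℕ) + 2 => X * chebS R (n + 1) - chebS R n
  | -((n : ℕ) + 1) => X * chebS R (-n) - chebS R (-n + 1)
  termination_by n => Int.natAbs n + Int.natAbs (n - 1)

theorem chebS_add_two (R : Type*) [CommRing R] :
    ∀ k : ℤ, chebS R (k + 2) = X * chebS R (k + 1) - chebS R k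
  | (k : ℕ) => chebS.eq_3 R k
  | -(k + 1 : ℕ) => by
    linear_combination (norm := (simp [Int.negSucc_eq]; ring_nf)) chebS.eq_4 R k

/-- The Cayley–Hamilton trace identity in `SL(2,ℂ)`. -/
theorem tr_mul_add_tr_inv_mul (G B : Matrix.SpecialLinearGroup (Fin 2) ℂ) :
    tr (G * B) + tr (G⁻¹ * B) = tr G * tr B := by
  simp only [tr, Matrix.SpecialLinearGroup.coe_mul, Matrix.SpecialLinearGroup.coe_inv,
    Matrix.adjugate_fin_two, Matrix.trace_fin_two, Matrix.mul_apply, Fin.sum_univ_two,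
    Matrix.of_apply, Matrix.cons_val', Matrix.cons_val_zero, Matrix.cons_val_one,
    Matrix.cons_val_fin_one]
  ring

theorem tr_mul_comm (G B : Matrix.SpecialLinearGroup (Fin 2) ℂ) : tr (G * B) = tr (B * G) := by
  simp only [tr, Matrix.SpecialLinearGroup.coe_mul]
  exact Matrix.trace_mul_comm _ _

theorem tr_one : tr 1 = 2 := by
  simp [tr]

theorem tr_zpow_add_two_mul (G B : Matrix.SpecialLinearGroup (Fin 2) ℂ) (k : ℤ) :
    tr (G ^ (k + 2) * B) = tr G * tr (G ^ (k + 1) * B) - tr (G ^ k * B) := by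
  have h := tr_mul_add_tr_inv_mul G (G ^ (k + 1) * B)
  have h_succ : G * (G ^ (k + 1) * B) = G ^ (k + 2) * B := by group
  have h_pred : G⁻¹ * (G ^ (k + 1) * B) = G ^ k * B := by group
  rw [h_succ, h_pred] at h
  linear_combination h

/-- Traces along the powers of `G` are governed by the Chebyshev polynomials at `tr G`. -/
theorem tr_zpow_mul (G B : Matrix.SpecialLinearGroup (Fin 2) ℂ) (k : ℤ) :
    tr (G ^ k * B)
      = tr B * (chebS ℂ k).eval (tr G) - tr (G⁻¹ * B) * (chebS ℂ (k - 1)).eval (tr G) := by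
  have eval_rec (j : ℤ) : (chebS ℂ (j + 2)).eval (tr G)
      = tr G * (chebS ℂ (j + 1)).eval (tr G) - (chebS ℂ j).eval (tr G) := by
    simp [chebS_add_two]
  have s_zero : (chebS ℂ 0).eval (tr G) = 1 := by simp [chebS]
  have s_one : (chebS ℂ 1).eval (tr G) = tr G := by simp [chebS]
  have s_neg_one : (chebS ℂ (-1)).eval (tr G) = 0 := by
    have h := eval_rec (-1)
    norm_num [s_zero, s_one] at h
    linear_combination h
  suffices h : ∀ j : ℤ,
      (tr (G ^ j * B) = tr B * (chebS ℂ j).eval (tr G)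
        - tr (G⁻¹ * B) * (chebS ℂ (j - 1)).eval (tr G)) ∧
      (tr (G ^ (j + 1) * B) = tr B * (chebS ℂ (j + 1)).eval (tr G)
        - tr (G⁻¹ * B) * (chebS ℂ j).eval (tr G)) from (h k).1
  intro j
  induction j using Int.induction_on with
  | zero =>
    constructor
    · simp [s_zero, s_neg_one]
    · simp only [zero_add, zpow_one, s_zero, s_one]
      linear_combination tr_mul_add_tr_inv_mul G B
  | succ i ih =>
    obtain ⟨h₀, h₁⟩ := ih
    have t := tr_zpow_add_two_mul G B i
    have e₀ := eval_rec (i - 1)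
    have e₁ := eval_rec i
    rw [show (i : ℤ) - 1 + 2 = i + 1 by ring, show (i : ℤ) - 1 + 1 = i by ring] at e₀
    rw [show (i : ℤ) + 1 - 1 = i by ring, show (i : ℤ) + 1 + 1 = i + 2 by ring]
    refine ⟨h₁, ?_⟩
    rw [t, h₀, h₁, e₁]
    linear_combination tr (G⁻¹ * B) * e₀
  | pred i ih =>
    obtain ⟨h₀, h₁⟩ := ih
    have t := tr_zpow_add_two_mul G B (-i - 1)
    have e₀ := eval_rec (-i - 1)
    have e₁ := eval_rec (-i - 1 - 1)
    rw [show -(i : ℤ) - 1 + 2 = -i + 1 by ring, show -(i : ℤ) - 1 + 1 = -i by ring] at t e₀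
    rw [show -(i : ℤ) - 1 - 1 + 2 = -i by ring, show -(i : ℤ) - 1 - 1 + 1 = -i - 1 by ring] at e₁
    rw [show -(i : ℤ) - 1 + 1 = -i by ring]
    refine ⟨?_, h₀⟩
    linear_combination t + tr G * h₀ - h₁ - tr B * e₀ + tr (G⁻¹ * B) * e₁

/-- With `x = tr A`, `y = tr W`, `z = tr (A*W)`, `β = tr (A*W*A*W⁻¹)`,
`U = (A*W*A*W⁻¹)^(1-m) * W` and `α = tr U`, one has
`tr (U^(n-1)*A*W*A) = (x*z - y) * S (n-1) (α) - (β * S (m-1) (β) - 2 * S (m-2) (β)) * S (n-2) (α)`. -/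
theorem trace_raw (A W : Matrix.SpecialLinearGroup (Fin 2) ℂ) (m n : ℤ) :
    tr (((A * W * A * W⁻¹) ^ (1 - m) * W) ^ (n - 1) * A * W * A)
      = (tr A * tr (A * W) - tr W)
          * (chebS ℂ (n - 1)).eval (tr ((A * W * A * W⁻¹) ^ (1 - m) * W))
        - (tr (A * W * A * W⁻¹) * (chebS ℂ (m - 1)).eval (tr (A * W * A * W⁻¹))
            - 2 * (chebS ℂ (m - 2)).eval (tr (A * W * A * W⁻¹)))
          * (chebS ℂ (n - 2)).eval (tr ((A * W * A * W⁻¹) ^ (1 - m) * W)) := by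
  set C := A * W * A * W⁻¹ with hC
  set V := C ^ (1 - m) * W with hV
  have h_AWA : tr (A * W * A) = tr A * tr (A * W) - tr W := by
    have h := tr_mul_add_tr_inv_mul A (A * W)
    rw [inv_mul_cancel_left] at h
    rw [tr_mul_comm (A * W) A]
    linear_combination h
  have h_inv : tr (V⁻¹ * (A * W * A)) = tr (C ^ (m - 1) * C) := by
    have h_conj : V⁻¹ * (A * W * A) = W⁻¹ * (C ^ (m - 1) * (A * W * A)) := by
      rw [hV, mul_inv_rev, ← zpow_neg, neg_sub, mul_assoc]
    rw [h_conj, tr_mul_comm, mul_assoc, ← hC]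
  have h_C := tr_zpow_mul C C (m - 1)
  rw [inv_mul_cancel, tr_one, show m - 1 - 1 = m - 2 by ring] at h_C
  have h_V := tr_zpow_mul V (A * W * A) (n - 1)
  rw [h_inv, h_C, h_AWA, show n - 1 - 1 = n - 2 by ring] at h_V
  rw [← h_V]
  simp only [mul_assoc]
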